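/- arXiv:1204.0254 — 2 statements merged into one kernel-verified Lean document; each statement's English description precedes it below -/
import Mathlib

section
/- Fix real Hecke parameters κ,λ,υ,ς and 0<q<1, and set a = q^{κ+λ}, b = −q^{κ−λ}, c = q^{1/2+υ+ς}, d = −q^{1/2+υ−ς}, ã = q^{κ+υ}, b̃ = −q^{κ−υ}, c̃ = q^{1/2+λ+ς}, d̃ = −q^{1/2+λ−ς}. Then for all x,z∈ℂ the following theta function identity holds: θ((d/ã)q^{x+z}, (d/ã)q^{x−z}, a q^x, b q^x, c q^x, d q^{−x}, q^{2z}; q) − θ((d/ã)q^{−x+z}, (d/ã)q^{x+z}, ã q^z, b̃ q^z, c̃ q^z, d̃ q^{−z}, q^{2x}; q) = q^{2x}·θ((d/ã)q^{−x−z}, (d/ã)q^{−x+z}, a q^{−x}, b q^{−x}, c q^{−x}, d q^x, q^{2z}; q) − q^{2z}·θ((d/ã)q^{−x−z}, (d/ã)q^{x−z}, ã q^{−z}, b̃ q^{−z}, c̃ q^{−z}, d̃ q^z, q^{2x}; q). -/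
noncomputable section

/-- `qc q x = q^x := exp(x·log q)` for a real base `q` and complex exponent `x`. -/
def qc (q : ℝ) (x : ℂ) : ℂ := Complex.exp (x * Complex.log (q : ℂ))

/-- Finite q-shifted factorial `(a;p)_n`. -/
def qPoch (a p : ℂ) (n : ℕ) : ℂ := ∏ i ∈ Finset.range n, (1 - a * p ^ i)

/-- Infinite q-shifted factorial `(a;p)_∞`. -/
def qPochInf (a p : ℂ) : ℂ := ∏' i : ℕ, (1 - a * p ^ i)

/-- Very-well-poised basic hypergeometric series `₈W₇(a₀;a₁,…,a₅;p,u)`. -/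
def W8 (a0 a1 a2 a3 a4 a5 p u : ℂ) : ℂ :=
  ∑' r : ℕ, ((1 - a0 * p ^ (2 * r)) / (1 - a0)) * u ^ r *
    ((qPoch a0 p r * qPoch a1 p r * qPoch a2 p r * qPoch a3 p r * qPoch a4 p r *
        qPoch a5 p r) /
      (qPoch (p * a0 / a0) p r * qPoch (p * a0 / a1) p r * qPoch (p * a0 / a2) p r *
        qPoch (p * a0 / a3) p r * qPoch (p * a0 / a4) p r * qPoch (p * a0 / a5) p r))

/-- All the "denominator" factors of the `₈W₇` series are nonzero. -/
def W8Denom (a0 a1 a2 a3 a4 a5 p : ℂ) : Prop :=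
  1 - a0 ≠ 0 ∧ ∀ r : ℕ,
    qPoch (p * a0 / a0) p r ≠ 0 ∧ qPoch (p * a0 / a1) p r ≠ 0 ∧
    qPoch (p * a0 / a2) p r ≠ 0 ∧ qPoch (p * a0 / a3) p r ≠ 0 ∧
    qPoch (p * a0 / a4) p r ≠ 0 ∧ qPoch (p * a0 / a5) p r ≠ 0

/-- Basic hypergeometric series `₄φ₃(a₁,a₂,a₃,a₄;b₁,b₂,b₃;p,u)`. -/
def phi43 (a1 a2 a3 a4 b1 b2 b3 p u : ℂ) : ℂ :=
  ∑' j : ℕ, (qPoch a1 p j * qPoch a2 p j * qPoch a3 p j * qPoch a4 p j) * u ^ j /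
    (qPoch p p j * qPoch b1 p j * qPoch b2 p j * qPoch b3 p j)

/-- Modified Jacobi theta function `θ(u;p)`. -/
def theta (u p : ℂ) : ℂ := qPochInf u p * qPochInf (p / u) p

/-- Askey–Wilson parameter `a_s = q^{κ+λ}`. -/
def aP (q : ℝ) (k lm : ℝ) : ℂ := qc q (k + lm)

/-- Askey–Wilson parameter `b_s = -q^{κ-λ}`. -/
def bP (q : ℝ) (k lm : ℝ) : ℂ := -qc q (k - lm)

/-- Askey–Wilson parameter `c_s = q^{s/2+υ+ς}`. -/
def cP (q : ℝ) (s up sg : ℝ) : ℂ := qc q (s / 2 + up + sg)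

/-- Askey–Wilson parameter `d_s = -q^{s/2+υ-ς}`. -/
def dP (q : ℝ) (s up sg : ℝ) : ℂ := -qc q (s / 2 + up - sg)

/-- The weight `W(x,z) = q^{(κ+λ+x)(κ+υ+z)/s}`. -/
def Wgt (q s k lm up : ℝ) (x z : ℂ) : ℂ := qc q ((k + lm + x) * (k + up + z) / s)

/-- The singular term `St(x)`; dual version is obtained by swapping `lm` and `up`. -/
def St (q s k lm up sg : ℝ) (x : ℂ) : ℂ :=
  qPochInf (qc q (s + x) / aP q k lm) (qc q s) * qPochInf (qc q (s + x) / bP q k lm) (qc q s) *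
  qPochInf (qc q (s + x) / cP q s up sg) (qc q s) *
  qPochInf (qc q (s + x) / dP q s up sg) (qc q s)

/-- The series part `Ψ(x,z)` of the asymptotically free eigenfunction. -/
def Psi (q s k lm up sg : ℝ) (x z : ℂ) : ℂ :=
  (qPochInf (qc q (s + x + z) * aP q k lm / aP q k up) (qc q s) *
   qPochInf (qc q (s + x + z) * bP q k lm / aP q k up) (qc q s) *
   qPochInf (qc q (s + x + z) * cP q s up sg / aP q k up) (qc q s) *
   qPochInf (qc q (s + x + z) * aP q k up / dP q s up sg) (qc q s) *
   qPochInf (qc q (s + 2 * z)) (qc q s) *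
   qPochInf (dP q s up sg * qc q x) (qc q s) /
   qPochInf (qc q (2 * s + x + 2 * z) / dP q s up sg) (qc q s)) *
  W8 (qc q (s + x + 2 * z) / dP q s up sg) (qc q (s + z) / aP q k up)
     (qc q (s + z) / dP q s lm sg) (bP q k up * qc q z) (cP q s lm sg * qc q z)
     (qc q (s + x) / dP q s up sg) (qc q s) (dP q s up sg * qc q x)

/-- The asymptotically free eigenfunction `Φ(x,z;κ,λ,υ,ς;q,s)`. -/
def Phi (q s k lm up sg : ℝ) (x z : ℂ) : ℂ :=
  Wgt q s k lm up x z * Psi q s k lm up sg x z /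
    (St q s k lm up sg x * St q s k up lm sg z)

/-- The Askey–Wilson function `E(x,z;κ,λ,υ,ς;q,s)`. -/
def AWE (q s k lm up sg : ℝ) (x z : ℂ) : ℂ :=
  (qPochInf (aP q k up * qc q (s + z - x) / dP q s up sg) (qc q s) *
   qPochInf (aP q k up * qc q (s + z + x) / dP q s up sg) (qc q s) *
   qPochInf (aP q k lm * bP q k lm) (qc q s) *
   qPochInf (aP q k lm * cP q s up sg) (qc q s) *
   qPochInf (qc q s * aP q k lm / dP q s up sg) (qc q s)) /
  (qPochInf (qc q (s + x) / dP q s up sg) (qc q s) *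
   qPochInf (qc q (s - x) / dP q s up sg) (qc q s) *
   qPochInf (qc q (s + z) / dP q s lm sg) (qc q s) *
   qPochInf (aP q k up * bP q k up * cP q s lm sg * qc q z) (qc q s)) *
  W8 (aP q k up * bP q k up * cP q s lm sg * qc q (-s + z))
     (aP q k lm * qc q x) (aP q k lm * qc q (-x)) (aP q k up * qc q z)
     (bP q k up * qc q z) (cP q s lm sg * qc q z) (qc q s) (qc q (s - z) / dP q s lm sg)

/-- The normalized `c`-function; the dual version swaps `lm` and `up`. -/
def cF (q s k lm up sg : ℝ) (x z : ℂ) : ℂ :=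
  (theta (aP q k up * qc q (-z)) (qc q s) * theta (bP q k up * qc q (-z)) (qc q s) *
   theta (cP q s lm sg * qc q (-z)) (qc q s) *
   theta (dP q s up sg * qc q (x - z) / aP q k up) (qc q s)) /
  (Wgt q s k lm up x z *
    (theta (qc q (-(2 * z))) (qc q s) * theta (dP q s up sg * qc q x) (qc q s)))

/-- The coefficient `A(x)` of the Askey–Wilson difference operator. -/
def AOp (q s k lm up sg : ℝ) (x : ℂ) : ℂ :=
  ((1 - aP q k lm * qc q x) * (1 - bP q k lm * qc q x) * (1 - cP q s up sg * qc q x) *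
    (1 - dP q s up sg * qc q x)) /
  (aP q k up * (1 - qc q (2 * x)) * (1 - qc q (s + 2 * x)))


/-- Product of seven modified Jacobi theta functions with the same base. -/
def th7 (u1 u2 u3 u4 u5 u6 u7 p : ℂ) : ℂ :=
  theta u1 p * theta u2 p * theta u3 p * theta u4 p * theta u5 p * theta u6 p * theta u7 p

/-- The general term `q^{k(k-1)/2} u^k` of the bilateral theta series. -/
def thetaTerm (q u : ℂ) (k : ℤ) : ℂ := q ^ (k * (k - 1) / 2) * u ^ k

theorem two_mul_triangle (k : ℤ) : 2 * (k * (k - 1) / 2) = k * (k - 1) :=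
  Int.mul_ediv_cancel' (even_iff_two_dvd.mp (Int.even_mul_pred_self k))

theorem thetaTerm_add_one {q u : ℂ} (hq : q ≠ 0) (hu : u ≠ 0) (k : ℤ) :
    thetaTerm q u (k + 1) = q ^ k * u * thetaTerm q u k := by
  have h : (k + 1) * (k + 1 - 1) / 2 = k + k * (k - 1) / 2 := by
    have h1 := two_mul_triangle k
    have h2 := two_mul_triangle (k + 1)
    linarith
  rw [thetaTerm, thetaTerm, h, zpow_add₀ hq, zpow_add_one₀ hu]
  ring

theorem thetaTerm_neg {q u : ℂ} (hq : q ≠ 0) (hu : u ≠ 0) (k : ℤ) :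
    thetaTerm q u (-k) = thetaTerm q (q / u) k := by
  have h : -k * (-k - 1) / 2 = k * (k - 1) / 2 + k := by
    have h1 := two_mul_triangle k
    have h2 := two_mul_triangle (-k)
    linarith
  rw [thetaTerm, thetaTerm, h, zpow_add₀ hq, div_zpow, zpow_neg]
  field_simp

theorem thetaTerm_ne_zero {q u : ℂ} (hq : q ≠ 0) (hu : u ≠ 0) (k : ℤ) :
    thetaTerm q u k ≠ 0 :=
  mul_ne_zero (zpow_ne_zero _ hq) (zpow_ne_zero _ hu)

theorem summable_norm_thetaTerm_nat {q u : ℂ} (hq : q ≠ 0) (hq1 : ‖q‖ < 1) (hu : u ≠ 0) :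
    Summable fun n : ℕ => ‖thetaTerm q u n‖ := by
  refine summable_of_ratio_test_tendsto_lt_one (l := 0) one_pos
    (Filter.Eventually.of_forall fun n => norm_ne_zero_iff.mpr (thetaTerm_ne_zero hq hu _)) ?_
  have h : Filter.Tendsto (fun n : ℕ => ‖q‖ ^ n * ‖u‖) Filter.atTop (nhds 0) := by
    simpa using (tendsto_pow_atTop_nhds_zero_of_lt_one (norm_nonneg q) hq1).mul_const ‖u‖
  refine h.congr fun n => ?_
  have hn := norm_ne_zero_iff.mpr (thetaTerm_ne_zero hq hu n)
  rw [Nat.cast_add_one, thetaTerm_add_one hq hu]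
  simp only [norm_norm, norm_mul, zpow_natCast, norm_pow]
  field_simp

theorem summable_norm_thetaTerm {q u : ℂ} (hq : q ≠ 0) (hq1 : ‖q‖ < 1) (hu : u ≠ 0) :
    Summable fun k : ℤ => ‖thetaTerm q u k‖ := by
  refine Summable.of_nat_of_neg (summable_norm_thetaTerm_nat hq hq1 hu) ?_
  simp only [thetaTerm_neg hq hu]
  exact summable_norm_thetaTerm_nat hq hq1 (div_ne_zero hq hu)

/-- The bilateral theta series `∑_k q^{k(k-1)/2} u^k`. -/
def thetaSeries (q u : ℂ) : ℂ := ∑' k : ℤ, thetaTerm q u k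

theorem hasSum_thetaSeries {q u : ℂ} (hq : q ≠ 0) (hq1 : ‖q‖ < 1) (hu : u ≠ 0) :
    HasSum (thetaTerm q u) (thetaSeries q u) :=
  (summable_norm_thetaTerm hq hq1 hu).of_norm.hasSum

theorem thetaSeries_eq_mul {q u : ℂ} (hq : q ≠ 0) (hu : u ≠ 0) :
    thetaSeries q u = u * thetaSeries q (q * u) := by
  rw [thetaSeries, ← (Equiv.addRight (1 : ℤ)).tsum_eq, thetaSeries, ← tsum_mul_left]
  refine tsum_congr fun k => ?_
  rw [Equiv.coe_addRight, thetaTerm_add_one hq hu, thetaTerm, thetaTerm, mul_zpow]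
  ring

/-- Splitting `ℤ × ℤ` by the parity of the sum of the coordinates. -/
def paritySplit : (ℤ × ℤ) ⊕ (ℤ × ℤ) → ℤ × ℤ :=
  Sum.elim (fun p => (p.1 + p.2, p.1 - p.2)) (fun p => (p.1 + p.2 + 1, p.1 - p.2))

theorem paritySplit_bijective : Function.Bijective paritySplit := by
  constructor
  · rintro (⟨a, b⟩ | ⟨a, b⟩) (⟨c, d⟩ | ⟨c, d⟩) h <;>
      simp only [paritySplit, Sum.elim_inl, Sum.elim_inr, Prod.mk.injEq] at h <;>
      simp only [Sum.inl.injEq, Sum.inr.injEq, Prod.mk.injEq, reduceCtorEq] <;> omega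
  · rintro ⟨m, n⟩
    rcases Int.even_or_odd' (m + n) with ⟨i, h | h⟩
    · exact ⟨Sum.inl (i, m - i), by
        simp only [paritySplit, Sum.elim_inl, Prod.mk.injEq]; omega⟩
    · exact ⟨Sum.inr (i, m - i - 1), by
        simp only [paritySplit, Sum.elim_inr, Prod.mk.injEq]; omega⟩

theorem thetaTerm_sq {q : ℂ} (u : ℂ) (k : ℤ) :
    thetaTerm (q ^ 2) u k = q ^ (k * (k - 1)) * u ^ k := by
  rw [thetaTerm, ← two_mul_triangle k, zpow_mul]
  simp [zpow_ofNat]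

theorem thetaTerm_mul_thetaTerm_even {q a b : ℂ} (hq : q ≠ 0) (ha : a ≠ 0) (hb : b ≠ 0)
    (i j : ℤ) :
    thetaTerm q (-(a * b)) (i + j) * thetaTerm q (-(a / b)) (i - j) =
      thetaTerm (q ^ 2) (a ^ 2) i * thetaTerm (q ^ 2) (q * b ^ 2) j := by
  have h : (i + j) * (i + j - 1) / 2 + (i - j) * (i - j - 1) / 2 =
      i * (i - 1) + j * (j - 1) + j := by
    have h1 := two_mul_triangle (i + j)
    have h2 := two_mul_triangle (i - j)
    linarith
  have hs : ((-1 : ℂ)) ^ (i + j) * (-1) ^ (i - j) = 1 := by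
    rw [← zpow_add₀ (by norm_num)]
    exact Even.neg_one_zpow ⟨i, by ring⟩
  rw [thetaTerm_sq, thetaTerm_sq, thetaTerm, thetaTerm, neg_eq_neg_one_mul (a * b),
    neg_eq_neg_one_mul (a / b), mul_zpow (-1), mul_zpow (-1)]
  calc _ = (q ^ ((i + j) * (i + j - 1) / 2) * q ^ ((i - j) * (i - j - 1) / 2)) *
        ((-1 : ℂ) ^ (i + j) * (-1) ^ (i - j)) * ((a * b) ^ (i + j) * (a / b) ^ (i - j)) := by ring
    _ = _ := by
      rw [hs, ← zpow_add₀ hq, h, zpow_add₀ hq, zpow_add₀ hq, mul_zpow, mul_zpow, div_zpow,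
        zpow_add₀ ha, zpow_add₀ hb, zpow_sub₀ ha, zpow_sub₀ hb, ← zpow_natCast, ← zpow_natCast,
        ← zpow_mul, ← zpow_mul]
      simp only [Nat.cast_ofNat, two_mul, zpow_add₀ ha, zpow_add₀ hb]
      field_simp

theorem thetaTerm_mul_thetaTerm_odd {q a b : ℂ} (hq : q ≠ 0) (ha : a ≠ 0) (hb : b ≠ 0)
    (i j : ℤ) :
    thetaTerm q (-(a * b)) (i + j + 1) * thetaTerm q (-(a / b)) (i - j) =
      -(a * b) * (thetaTerm (q ^ 2) (q * a ^ 2) i * thetaTerm (q ^ 2) (q ^ 2 * b ^ 2) j) := by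
  rw [thetaTerm_add_one hq (neg_ne_zero.mpr (mul_ne_zero ha hb)), mul_assoc (_ * _),
    thetaTerm_mul_thetaTerm_even hq ha hb, thetaTerm, thetaTerm, thetaTerm, thetaTerm,
    mul_zpow q, mul_zpow q, mul_zpow (q ^ 2), zpow_add₀ hq, pow_two q, mul_zpow q q j]
  ring

theorem thetaSeries_mul_thetaSeries {q a b : ℂ} (hq : q ≠ 0) (hq1 : ‖q‖ < 1) (ha : a ≠ 0)
    (hb : b ≠ 0) :
    thetaSeries q (-(a * b)) * thetaSeries q (-(a / b)) =
      a * (a * thetaSeries (q ^ 2) (q ^ 2 * a ^ 2) * thetaSeries (q ^ 2) (q * b ^ 2) -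
        thetaSeries (q ^ 2) (q * a ^ 2) * (b * thetaSeries (q ^ 2) (q ^ 2 * b ^ 2))) := by
  have hq2 : q ^ 2 ≠ 0 := pow_ne_zero 2 hq
  have hq21 : ‖q ^ 2‖ < 1 := by
    rw [norm_pow]; exact pow_lt_one₀ (norm_nonneg q) hq1 two_ne_zero
  have ha2 : a ^ 2 ≠ 0 := pow_ne_zero 2 ha
  have hb2 : b ^ 2 ≠ 0 := pow_ne_zero 2 hb
  have hprod : ∀ {p u v : ℂ}, p ≠ 0 → ‖p‖ < 1 → u ≠ 0 → v ≠ 0 →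
      HasSum (fun x : ℤ × ℤ => thetaTerm p u x.1 * thetaTerm p v x.2)
        (thetaSeries p u * thetaSeries p v) := fun hp hp1 hu hv =>
    (hasSum_thetaSeries hp hp1 hu).mul (hasSum_thetaSeries hp hp1 hv)
      (summable_mul_of_summable_norm (summable_norm_thetaTerm hp hp1 hu)
        (summable_norm_thetaTerm hp hp1 hv))
  have hL := hprod hq hq1 (neg_ne_zero.mpr (mul_ne_zero ha hb))
    (neg_ne_zero.mpr (div_ne_zero ha hb))
  have hE := hprod hq2 hq21 ha2 (mul_ne_zero hq hb2)
  have hO := (hprod hq2 hq21 (mul_ne_zero hq ha2) (mul_ne_zero hq2 hb2)).mul_left (-(a * b))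
  rw [← (Equiv.ofBijective _ paritySplit_bijective).hasSum_iff] at hL
  have hR := HasSum.sum (f := (fun x : ℤ × ℤ =>
    thetaTerm q (-(a * b)) x.1 * thetaTerm q (-(a / b)) x.2) ∘
      Equiv.ofBijective _ paritySplit_bijective)
    (hE.congr_fun fun x => thetaTerm_mul_thetaTerm_even hq ha hb x.1 x.2)
    (hO.congr_fun fun x => thetaTerm_mul_thetaTerm_odd hq ha hb x.1 x.2)
  rw [hL.unique hR, thetaSeries_eq_mul hq2 ha2]
  ring

theorem summable_mul_pow_norm {q : ℂ} (hq1 : ‖q‖ < 1) (u : ℂ) :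
    Summable fun i : ℕ => ‖-(u * q ^ i)‖ := by
  simpa using (summable_geometric_of_lt_one (norm_nonneg q) hq1).mul_left ‖u‖

theorem qPoch_succ (a p : ℂ) (n : ℕ) : qPoch a p (n + 1) = qPoch a p n * (1 - a * p ^ n) :=
  Finset.prod_range_succ _ _

theorem tendsto_qPoch {q : ℂ} (hq1 : ‖q‖ < 1) (u : ℂ) :
    Filter.Tendsto (qPoch u q) Filter.atTop (nhds (qPochInf u q)) := by
  have h := (multipliable_one_add_of_summable (summable_mul_pow_norm hq1 u)).hasProd.tendsto_prod_nat
  simp only [← sub_eq_add_neg] at h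
  exact h

theorem qPochInf_ne_zero {q u : ℂ} (hq1 : ‖q‖ < 1) (h : ∀ i : ℕ, 1 - u * q ^ i ≠ 0) :
    qPochInf u q ≠ 0 := by
  have := tprod_one_add_ne_zero_of_summable (f := fun i : ℕ => -(u * q ^ i))
    (fun i => by simpa only [← sub_eq_add_neg] using h i) (summable_mul_pow_norm hq1 u)
  simp only [← sub_eq_add_neg] at this
  exact this

theorem one_sub_mul_pow_self_ne_zero {q : ℂ} (hq1 : ‖q‖ < 1) (i : ℕ) : 1 - q * q ^ i ≠ 0 := by
  intro h
  have h1 : ‖q ^ (i + 1)‖ < 1 := by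
    rw [norm_pow]; exact pow_lt_one₀ (norm_nonneg q) hq1 i.succ_ne_zero
  rw [pow_succ', ← sub_eq_zero.mp h, norm_one] at h1
  exact lt_irrefl _ h1

theorem qPoch_self_ne_zero {q : ℂ} (hq1 : ‖q‖ < 1) (n : ℕ) : qPoch q q n ≠ 0 :=
  Finset.prod_ne_zero_iff.mpr fun i _ => one_sub_mul_pow_self_ne_zero hq1 i

/-- The reciprocal `1/(q;q)_j`, extended by zero to negative `j`. -/
def qPochRecip (q : ℂ) (j : ℤ) : ℂ := if 0 ≤ j then (qPoch q q j.toNat)⁻¹ else 0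

theorem qPochRecip_natCast (q : ℂ) (n : ℕ) : qPochRecip q n = (qPoch q q n)⁻¹ := by
  simp [qPochRecip]

theorem qPochRecip_sub_one {q : ℂ} (hq1 : ‖q‖ < 1) (j : ℤ) :
    qPochRecip q (j - 1) = (1 - q ^ j) * qPochRecip q j := by
  rcases lt_trichotomy j 0 with h | rfl | h
  · simp [qPochRecip, show ¬ 0 ≤ j by omega, show ¬ 1 ≤ j by omega]
  · simp [qPochRecip]
  · obtain ⟨n, rfl⟩ : ∃ n : ℕ, j = n + 1 := ⟨(j - 1).toNat, by omega⟩
    have h1 := one_sub_mul_pow_self_ne_zero hq1 n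
    have h2 := qPoch_self_ne_zero hq1 n
    rw [add_sub_cancel_right, qPochRecip_natCast, ← Nat.cast_succ, qPochRecip_natCast, qPoch_succ,
      zpow_natCast, pow_succ']
    field_simp

theorem tendsto_qPochRecip {q : ℂ} (hq1 : ‖q‖ < 1) (k : ℤ) :
    Filter.Tendsto (fun N : ℕ => qPochRecip q (N + k)) Filter.atTop
      (nhds (qPochInf q q)⁻¹) := by
  have h0 : qPochInf q q ≠ 0 := qPochInf_ne_zero hq1 (one_sub_mul_pow_self_ne_zero hq1)
  have h := (tendsto_qPoch hq1 q).inv₀ h0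
  have hk : Filter.Tendsto (fun N : ℕ => ((N : ℤ) + k).toNat) Filter.atTop Filter.atTop :=
    Filter.tendsto_atTop.mpr fun b => by
      filter_upwards [Filter.eventually_ge_atTop (b + k.natAbs)] with N hN
      omega
  refine (h.comp hk).congr' ?_
  filter_upwards [Filter.eventually_ge_atTop k.natAbs] with N hN
  simp [qPochRecip, show 0 ≤ (N : ℤ) + k by omega]

theorem exists_norm_qPochRecip_le {q : ℂ} (hq1 : ‖q‖ < 1) :
    ∃ C : ℝ, ∀ j, ‖qPochRecip q j‖ ≤ C := by
  obtain ⟨C, hC⟩ := (Metric.isBounded_range_of_tendsto _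
    (tendsto_qPochRecip hq1 0)).exists_norm_le
  refine ⟨C, fun j => ?_⟩
  by_cases hj : 0 ≤ j
  · exact hC _ ⟨j.toNat, by simp [hj]⟩
  · have : ‖qPochRecip q ((0 : ℕ) + 0)‖ ≤ C := hC _ ⟨0, rfl⟩
    simpa [qPochRecip, hj] using (norm_nonneg _).trans this

/-- The coefficient `(q;q)_{2N} / ((q;q)_{N-k} (q;q)_{N+k})` of the finite triple product. -/
def tripleCoeff (q : ℂ) (N : ℕ) (k : ℤ) : ℂ :=
  qPoch q q (2 * N) * (qPochRecip q (N - k) * qPochRecip q (N + k))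

theorem tripleCoeff_succ {q : ℂ} (hq : q ≠ 0) (hq1 : ‖q‖ < 1) (N : ℕ) (k : ℤ) :
    tripleCoeff q (N + 1) k = (1 + q ^ (2 * N + 1)) * tripleCoeff q N k +
      q ^ (N + 1 - k : ℤ) * tripleCoeff q N (k - 1) +
      q ^ (N + 1 + k : ℤ) * tripleCoeff q N (k + 1) := by
  have hM : q ^ (N + 1 - k : ℤ) * q ^ (N + 1 + k : ℤ) = q ^ (2 * N) * q ^ 2 := by
    rw [← zpow_add₀ hq, ← pow_add, ← zpow_natCast]
    congr 1
    push_cast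
    ring
  have a1 : qPochRecip q (N - k) = (1 - q ^ (N + 1 - k : ℤ)) * qPochRecip q (N + 1 - k) := by
    rw [← qPochRecip_sub_one hq1]; congr 1; ring
  have a2 : qPochRecip q (N + k) = (1 - q ^ (N + 1 + k : ℤ)) * qPochRecip q (N + 1 + k) := by
    rw [← qPochRecip_sub_one hq1]; congr 1; ring
  have a3 : qPochRecip q (N - (k + 1)) = (1 - q ^ (N + 1 - k : ℤ) / q) * qPochRecip q (N - k) := by
    rw [div_eq_mul_inv, ← zpow_sub_one₀ hq, show (N : ℤ) + 1 - k - 1 = N - k by ring, ← qPochRecip_sub_one hq1]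
    congr 1; ring
  have a4 : qPochRecip q (N + (k - 1)) = (1 - q ^ (N + 1 + k : ℤ) / q) * qPochRecip q (N + k) := by
    rw [div_eq_mul_inv, ← zpow_sub_one₀ hq, show (N : ℤ) + 1 + k - 1 = N + k by ring, ← qPochRecip_sub_one hq1]
    congr 1; ring
  have a5 : qPoch q q (2 * (N + 1)) =
      qPoch q q (2 * N) * (1 - q * q ^ (2 * N)) * (1 - q ^ 2 * q ^ (2 * N)) := by
    rw [show 2 * (N + 1) = 2 * N + 1 + 1 by ring, qPoch_succ, qPoch_succ]
    ring
  simp only [tripleCoeff, a5]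
  rw [show (N : ℤ) - (k - 1) = N + 1 - k by ring, show (N : ℤ) + (k + 1) = N + 1 + k by ring,
    a3, a4, a1, a2, Nat.cast_add_one, pow_succ q (2 * N)]
  generalize q ^ (N + 1 - k : ℤ) = X at *
  generalize q ^ (N + 1 + k : ℤ) = Y at *
  generalize q ^ (2 * N) = M at *
  generalize qPochRecip q (N + 1 - k) = R
  generalize qPochRecip q (N + 1 + k) = S
  generalize qPoch q q (2 * N) = Z
  field_simp
  linear_combination (Z * R * S) * (2 + q - q ^ 2 * M - X - Y) * hM

theorem hasSum_finite_triple {q u : ℂ} (hq : q ≠ 0) (hq1 : ‖q‖ < 1) (hu : u ≠ 0) (N : ℕ) :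
    HasSum (fun k => tripleCoeff q N k * thetaTerm q (-u) k)
      (qPoch u q N * qPoch (q / u) q N) := by
  induction N with
  | zero =>
    convert hasSum_ite_eq (0 : ℤ) (1 : ℂ) using 1
    · funext k
      rcases lt_trichotomy k 0 with h | rfl | h
      · simp [tripleCoeff, qPochRecip, h.ne, h.not_ge]
      · simp [tripleCoeff, qPochRecip, qPoch, thetaTerm]
      · simp [tripleCoeff, qPochRecip, h.ne', h.not_ge]
    · simp [qPoch]
  | succ N ih =>
    have hu' := neg_ne_zero.mpr hu
    have h1 := ih.mul_left (1 + q ^ (2 * N + 1))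
    have h2 := ((Equiv.subRight (1 : ℤ)).hasSum_iff.mpr ih).mul_left (-u * q ^ N)
    have h3 := ((Equiv.addRight (1 : ℤ)).hasSum_iff.mpr ih).mul_left (-q ^ (N + 1) / u)
    refine ((congrArg₂ HasSum (funext fun k => ?_) ?_).mpr ((h1.add h2).add h3))
    · have e1 := thetaTerm_add_one hq hu' (k - 1)
      have e2 := thetaTerm_add_one hq hu' k
      rw [sub_add_cancel] at e1
      simp only [Function.comp_apply, Equiv.subRight_apply, Equiv.coe_addRight]
      have e3 : -u * q ^ N * thetaTerm q (-u) (k - 1) =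
          q ^ (N + 1 - k : ℤ) * thetaTerm q (-u) k := by
        rw [e1, ← mul_assoc, ← mul_assoc, ← zpow_add₀ hq,
          show (N : ℤ) + 1 - k + (k - 1) = N by ring, zpow_natCast]
        ring
      rw [tripleCoeff_succ hq hq1, e2, zpow_add₀ hq (N + 1 : ℤ), ← Nat.cast_succ, zpow_natCast]
      rw [← Nat.cast_succ] at e3
      field_simp
      linear_combination -tripleCoeff q N (k - 1) * e3
    · rw [qPoch_succ, qPoch_succ]
      field_simp
      ring

/-- The Jacobi triple product identity. -/
theorem thetaSeries_neg_eq {q u : ℂ} (hq : q ≠ 0) (hq1 : ‖q‖ < 1) (hu : u ≠ 0) :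
    thetaSeries q (-u) = qPochInf q q * theta u q := by
  have h0 : qPochInf q q ≠ 0 := qPochInf_ne_zero hq1 (one_sub_mul_pow_self_ne_zero hq1)
  obtain ⟨C, hC⟩ := exists_norm_qPochRecip_le hq1
  obtain ⟨D, hD⟩ := (Metric.isBounded_range_of_tendsto _ (tendsto_qPoch hq1 q)).exists_norm_le
  have hC0 : 0 ≤ C := (norm_nonneg _).trans (hC 0)
  have hD0 : 0 ≤ D := (norm_nonneg _).trans (hD _ ⟨0, rfl⟩)
  have hlim : Filter.Tendsto (fun N => ∑' k, tripleCoeff q N k * thetaTerm q (-u) k) Filter.atTop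
      (nhds (∑' k, (qPochInf q q)⁻¹ * thetaTerm q (-u) k)) := by
    refine tendsto_tsum_of_dominated_convergence
      (bound := fun k => D * (C * C) * ‖thetaTerm q (-u) k‖)
      ((summable_norm_thetaTerm hq hq1 (neg_ne_zero.mpr hu)).mul_left _) (fun k => ?_)
      (Filter.Eventually.of_forall fun N k => ?_)
    · have h2 : Filter.Tendsto (fun N : ℕ => 2 * N) Filter.atTop Filter.atTop :=
        Filter.tendsto_id.const_mul_atTop' two_pos
      have h := ((tendsto_qPoch hq1 q).comp h2).mul
        ((tendsto_qPochRecip hq1 (-k)).mul (tendsto_qPochRecip hq1 k))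
      rw [mul_inv_cancel_left₀ h0] at h
      exact h.mul_const _
    · rw [norm_mul, tripleCoeff, norm_mul, norm_mul]
      have := hD _ ⟨2 * N, rfl⟩
      gcongr
      · exact hC _
      · exact hC _
  have hfin := ((tendsto_qPoch hq1 u).mul (tendsto_qPoch hq1 (q / u)))
  simp only [(hasSum_finite_triple hq hq1 hu _).tsum_eq] at hlim
  have h := tendsto_nhds_unique hlim hfin
  rw [tsum_mul_left, ← thetaSeries, ← theta] at h
  rw [← h, mul_inv_cancel_left₀ h0]

/-- Products `θ(ab) θ(a/b)` are governed by a two-dimensional space of even functions. -/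
theorem exists_theta_mul_theta {q : ℂ} (hq : q ≠ 0) (hq1 : ‖q‖ < 1) :
    ∃ G H : ℂ → ℂ, ∀ a b : ℂ, a ≠ 0 → b ≠ 0 →
      theta (a * b) q * theta (a / b) q = a * (H a * G b - G a * H b) := by
  have h0 : qPochInf q q ≠ 0 := qPochInf_ne_zero hq1 (one_sub_mul_pow_self_ne_zero hq1)
  refine ⟨fun a => thetaSeries (q ^ 2) (q * a ^ 2) / qPochInf q q,
    fun a => a * thetaSeries (q ^ 2) (q ^ 2 * a ^ 2) / qPochInf q q, fun a b ha hb => ?_⟩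
  have h := thetaSeries_mul_thetaSeries hq hq1 ha hb
  rw [thetaSeries_neg_eq hq hq1 (mul_ne_zero ha hb),
    thetaSeries_neg_eq hq hq1 (div_ne_zero ha hb)] at h
  rw [div_mul_div_comm, div_mul_div_comm, ← sub_div, mul_div_assoc', eq_div_iff (mul_ne_zero h0 h0)]
  linear_combination h

/-- The four-term identity for an odd function whose products `s (p + r) * s (p - r)` are
two-by-two determinants, at a point where `s (2 * x)` does not vanish. -/
theorem four_term_of_ne_zero {s G H : ℂ → ℂ} (hodd : ∀ y, s (-y) = -s y)
    (hs : ∀ p r, H p * G r - G p * H r = s (p + r) * s (p - r)) {e m x : ℂ} (n p z : ℂ)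
    (hm : s (2 * m) ≠ 0) (he : s (2 * m + 2 * e) ≠ 0) (hx : s (2 * x) ≠ 0) :
    s (2 * z) *
        (s (e + x + z) * s (e + x - z) * (s (m + x + n) * s (m + x - n)) *
            (s (m + e - x + p) * s (m + e - x - p)) -
          s (e - x + z) * s (e - x - z) * (s (m - x + n) * s (m - x - n)) *
            (s (m + e + x + p) * s (m + e + x - p))) =
      s (2 * x) *
        (s (e + z + x) * s (e + z - x) * (s (m + e - z + n) * s (m + e - z - n)) *
            (s (m + z + p) * s (m + z - p)) -
          s (e - z + x) * s (e - z - x) * (s (m + e + z + n) * s (m + e + z - n)) *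
            (s (m - z + p) * s (m - z - p))) := by
  have hdet : ∀ {p r y w : ℂ}, p + r = y → p - r = w → H p * G r - G p * H r = s y * s w := by
    rintro p r _ _ rfl rfl; exact hs p r
  have hdet' : ∀ {p r y w : ℂ}, p + r = y → p - r = -w →
      H p * G r - G p * H r = -(s y * s w) := by
    intro p r y w h1 h2; rw [hdet h1 h2, hodd]; ring
  have three_term : ∀ a b c d : ℂ,
      (H a * G b - G a * H b) * (H c * G d - G c * H d) =
        (H c * G b - G c * H b) * (H a * G d - G a * H d) +
          (H a * G c - G a * H c) * (H b * G d - G b * H d) := fun a b c d => by ring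
  have hC := three_term (m + x) (m - x) (m + e - z) n
  have hD := three_term (m + x) (m - x) (m + e + z) n
  have hC' := three_term (m + e - x) (m + e + x) (m + z) p
  have hD' := three_term (m + e - x) (m + e + x) (m - z) p
  have hW := three_term (x + z) (x - z) (2 * m + e) e
  rw [hs (m + x) n, hs (m - x) n, hs (m + e - z) n,
    hdet (y := 2 * m) (w := 2 * x) (by ring) (by ring),
    hdet (y := 2 * m + e - x - z) (w := e + x - z) (by ring) (by ring),
    hdet' (y := 2 * m + e + x - z) (w := e - x - z) (by ring) (by ring)] at hC
  rw [hs (m + x) n, hs (m - x) n, hs (m + e + z) n,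
    hdet (y := 2 * m) (w := 2 * x) (by ring) (by ring),
    hdet (y := 2 * m + e - x + z) (w := e + x + z) (by ring) (by ring),
    hdet' (y := 2 * m + e + x + z) (w := e - x + z) (by ring) (by ring)] at hD
  rw [hs (m + e - x) p, hs (m + e + x) p, hs (m + z) p,
    hdet' (y := 2 * m + 2 * e) (w := 2 * x) (by ring) (by ring),
    hdet' (y := 2 * m + e + x + z) (w := e + x - z) (by ring) (by ring),
    hdet (y := 2 * m + e - x + z) (w := e - x - z) (by ring) (by ring)] at hC'
  rw [hs (m + e - x) p, hs (m + e + x) p, hs (m - z) p,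
    hdet' (y := 2 * m + 2 * e) (w := 2 * x) (by ring) (by ring),
    hdet' (y := 2 * m + e + x - z) (w := e + x + z) (by ring) (by ring),
    hdet (y := 2 * m + e - x - z) (w := e - x + z) (by ring) (by ring)] at hD'
  rw [hdet (y := 2 * x) (w := 2 * z) (by ring) (by ring),
    hdet (y := 2 * m + 2 * e) (w := 2 * m) (by ring) (by ring),
    hdet (p := 2 * m + e) (r := x - z) (y := 2 * m + e + x - z) (w := 2 * m + e - x + z)
      (by ring) (by ring),
    hdet' (p := x + z) (y := e + x + z) (w := e - x - z) (by ring) (by ring),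
    hdet' (p := x + z) (r := 2 * m + e) (y := 2 * m + e + x + z) (w := 2 * m + e - x - z)
      (by ring) (by ring),
    hdet' (p := x - z) (y := e + x - z) (w := e - x + z) (by ring) (by ring)] at hW
  rw [show e + z + x = e + x + z by ring, show e + z - x = e - x + z by ring,
    show e - z + x = e + x - z by ring, show e - z - x = e - x - z by ring]
  refine mul_left_cancel₀ (mul_ne_zero (mul_ne_zero hm hx) (neg_ne_zero.mpr (mul_ne_zero he hx))) ?_
  generalize s (m + x + n) * s (m + x - n) = An at *
  generalize s (m - x + n) * s (m - x - n) = Bn at *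
  generalize s (m + e - z + n) * s (m + e - z - n) = Cn at *
  generalize s (m + e + z + n) * s (m + e + z - n) = Dn at *
  generalize s (m + e - x + p) * s (m + e - x - p) = Ap at *
  generalize s (m + e + x + p) * s (m + e + x - p) = Bp at *
  generalize s (m + z + p) * s (m + z - p) = Cp at *
  generalize s (m - z + p) * s (m - z - p) = Dp at *
  have hCC := congrArg₂ (· * ·) hC hC'
  have hDD := congrArg₂ (· * ·) hD hD'
  linear_combination
    (-s (2 * x) * (s (e + x + z) * s (e + x - z) * An * Ap -
      s (e - x + z) * s (e - x - z) * Bn * Bp)) * hW -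
    s (2 * x) * s (e + x + z) * s (e - x + z) * hCC +
    s (2 * x) * s (e + x - z) * s (e - x - z) * hDD

/-- The four-term identity for an odd function whose products `s (p + r) * s (p - r)` are
two-by-two determinants. -/
theorem four_term {s G H : ℂ → ℂ} (hodd : ∀ y, s (-y) = -s y)
    (hs : ∀ p r, H p * G r - G p * H r = s (p + r) * s (p - r)) {e m : ℂ} (n p x z : ℂ)
    (hm : s (2 * m) ≠ 0) (he : s (2 * m + 2 * e) ≠ 0) :
    s (2 * z) *
        (s (e + x + z) * s (e + x - z) * (s (m + x + n) * s (m + x - n)) *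
            (s (m + e - x + p) * s (m + e - x - p)) -
          s (e - x + z) * s (e - x - z) * (s (m - x + n) * s (m - x - n)) *
            (s (m + e + x + p) * s (m + e + x - p))) =
      s (2 * x) *
        (s (e + z + x) * s (e + z - x) * (s (m + e - z + n) * s (m + e - z - n)) *
            (s (m + z + p) * s (m + z - p)) -
          s (e - z + x) * s (e - z - x) * (s (m + e + z + n) * s (m + e + z - n)) *
            (s (m - z + p) * s (m - z - p))) := by
  by_cases hx : s (2 * x) = 0
  · by_cases hz : s (2 * z) = 0
    · rw [hx, hz, zero_mul, zero_mul]
    · linear_combination -four_term_of_ne_zero hodd hs p n x hm he hz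
  · exact four_term_of_ne_zero hodd hs n p z hm he hx

theorem qPochInf_eq_mul {q : ℂ} (hq1 : ‖q‖ < 1) (u : ℂ) :
    qPochInf u q = (1 - u) * qPochInf (q * u) q := by
  have h := (tendsto_qPoch hq1 (q * u)).const_mul (1 - u)
  refine tendsto_nhds_unique ((tendsto_qPoch hq1 u).comp (Filter.tendsto_add_atTop_nat 1)) ?_
  refine h.congr fun n => ?_
  rw [Function.comp_apply, qPoch, qPoch, Finset.prod_range_succ', pow_zero, mul_one, mul_comm]
  refine congrArg (· * (1 - u)) (Finset.prod_congr rfl fun i _ => ?_)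
  ring

theorem theta_inv {q u : ℂ} (hq1 : ‖q‖ < 1) (hu : u ≠ 0) : theta u⁻¹ q = -u⁻¹ * theta u q := by
  rw [theta, theta, div_inv_eq_mul, qPochInf_eq_mul hq1 u, qPochInf_eq_mul hq1 u⁻¹,
    ← div_eq_mul_inv q]
  field_simp
  ring

theorem theta_div {q u : ℂ} (hq : q ≠ 0) : theta (q / u) q = theta u q := by
  rw [theta, theta, div_div_cancel₀ hq, mul_comm]

/-- The odd normalisation `e^{-y/2} θ(e^y; q)` of the theta function. -/
def oddTheta (q y : ℂ) : ℂ := Complex.exp (-y / 2) * theta (Complex.exp y) q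

theorem theta_exp (q y : ℂ) : theta (Complex.exp y) q = Complex.exp (y / 2) * oddTheta q y := by
  rw [oddTheta, ← mul_assoc, ← Complex.exp_add, show y / 2 + -y / 2 = 0 by ring, Complex.exp_zero,
    one_mul]

theorem oddTheta_neg {q : ℂ} (hq1 : ‖q‖ < 1) (y : ℂ) : oddTheta q (-y) = -oddTheta q y := by
  rw [oddTheta, oddTheta, Complex.exp_neg y, theta_inv hq1 (Complex.exp_ne_zero y),
    ← Complex.exp_neg, neg_mul, mul_neg, ← mul_assoc, ← Complex.exp_add]
  congr 3
  ring

theorem exists_oddTheta_mul_oddTheta {q : ℂ} (hq : q ≠ 0) (hq1 : ‖q‖ < 1) :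
    ∃ G H : ℂ → ℂ, ∀ p r,
      H p * G r - G p * H r = oddTheta q (p + r) * oddTheta q (p - r) := by
  obtain ⟨G, H, h⟩ := exists_theta_mul_theta hq hq1
  refine ⟨fun p => G (Complex.exp p), fun p => H (Complex.exp p), fun p r => ?_⟩
  have h1 := h _ _ (Complex.exp_ne_zero p) (Complex.exp_ne_zero r)
  rw [← Complex.exp_add, ← Complex.exp_sub, theta_exp, theta_exp] at h1
  refine mul_left_cancel₀ (Complex.exp_ne_zero p) (h1.symm.trans ?_)
  rw [show p = (p + r) / 2 + (p - r) / 2 by ring, Complex.exp_add]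
  ring_nf

theorem theta_ne_zero_of_neg {q t : ℝ} (hq0 : 0 < q) (hq1 : q < 1) (ht : t < 0) :
    theta (t : ℂ) (q : ℂ) ≠ 0 := by
  have hn : ‖(q : ℂ)‖ < 1 := by simpa [abs_of_pos hq0] using hq1
  have key : ∀ v : ℝ, v < 0 → qPochInf (v : ℂ) (q : ℂ) ≠ 0 := fun v hv =>
    qPochInf_ne_zero hn fun i => by
      have h : 0 < 1 - v * q ^ i := by nlinarith [pow_pos hq0 i]
      exact_mod_cast h.ne'
  refine mul_ne_zero (key t ht) ?_
  rw [← Complex.ofReal_div]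
  exact key _ (div_neg_of_pos_of_neg hq0 ht)

theorem oddTheta_ne_zero {q t : ℝ} {y : ℂ} (hq0 : 0 < q) (hq1 : q < 1)
    (hy : Complex.exp y = -Complex.exp t) : oddTheta q y ≠ 0 := by
  refine mul_ne_zero (Complex.exp_ne_zero _) ?_
  rw [hy, ← Complex.ofReal_exp, ← Complex.ofReal_neg]
  exact theta_ne_zero_of_neg hq0 hq1 (neg_neg_of_pos (Real.exp_pos t))

theorem th7_eq {q u1 u2 u3 u4 u5 u6 u7 y1 y2 y3 y4 y5 y6 y7 : ℂ} (hq : q ≠ 0)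
    (h1 : u1 = Complex.exp y1) (h2 : u2 = Complex.exp y2) (h3 : u3 = Complex.exp y3)
    (h4 : u4 = Complex.exp y4) (h5 : u5 = q / Complex.exp y5) (h6 : u6 = Complex.exp y6)
    (h7 : u7 = Complex.exp y7) :
    th7 u1 u2 u3 u4 u5 u6 u7 q = Complex.exp ((y1 + y2 + y3 + y4 + y5 + y6 + y7) / 2) *
      (oddTheta q y1 * oddTheta q y2 * oddTheta q y3 * oddTheta q y4 * oddTheta q y5 *
        oddTheta q y6 * oddTheta q y7) := by
  subst h1 h2 h3 h4 h5 h6 h7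
  rw [th7, theta_div hq]
  simp only [theta_exp, add_div, Complex.exp_add]
  ring

/-- the six-parameter theta function identity (the `s = 1` case of
the c-function identity; a subcase of Slater's identity). -/
theorem stmt8 (q k lm up sg : ℝ) (hq0 : 0 < q) (hq1 : q < 1) (x z : ℂ) :
    th7 (dP q 1 up sg / aP q k up * qc q (x + z)) (dP q 1 up sg / aP q k up * qc q (x - z))
        (aP q k lm * qc q x) (bP q k lm * qc q x) (cP q 1 up sg * qc q x)
        (dP q 1 up sg * qc q (-x)) (qc q (2 * z)) (q : ℂ) -
      th7 (dP q 1 up sg / aP q k up * qc q (-x + z))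
        (dP q 1 up sg / aP q k up * qc q (x + z)) (aP q k up * qc q z)
        (bP q k up * qc q z) (cP q 1 lm sg * qc q z) (dP q 1 lm sg * qc q (-z))
        (qc q (2 * x)) (q : ℂ) =
    qc q (2 * x) *
        th7 (dP q 1 up sg / aP q k up * qc q (-x - z))
          (dP q 1 up sg / aP q k up * qc q (-x + z)) (aP q k lm * qc q (-x))
          (bP q k lm * qc q (-x)) (cP q 1 up sg * qc q (-x)) (dP q 1 up sg * qc q x)
          (qc q (2 * z)) (q : ℂ) -
      qc q (2 * z) *
        th7 (dP q 1 up sg / aP q k up * qc q (-x - z))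
          (dP q 1 up sg / aP q k up * qc q (x - z)) (aP q k up * qc q (-z))
          (bP q k up * qc q (-z)) (cP q 1 lm sg * qc q (-z)) (dP q 1 lm sg * qc q z)
          (qc q (2 * x)) (q : ℂ) := by
  have hq : (q : ℂ) ≠ 0 := by exact_mod_cast hq0.ne'
  have hn : ‖(q : ℂ)‖ < 1 := by simpa [abs_of_pos hq0] using hq1
  set l : ℝ := Real.log q with hl
  have hlog : Complex.log (q : ℂ) = l := (Complex.ofReal_log hq0.le).symm
  have hql : (q : ℂ) = Complex.exp l := by rw [← Complex.ofReal_exp, hl, Real.exp_log hq0]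
  set J : ℂ := Real.pi * Complex.I
  have hJ1 : Complex.exp J = -1 := Complex.exp_pi_mul_I
  have hneg : ∀ w, -Complex.exp w = Complex.exp (w + J) := fun w => by
    rw [Complex.exp_add, hJ1]; ring
  have hper : ∀ w, Complex.exp (w + 2 * J) = Complex.exp w := fun w => by
    rw [two_mul, ← add_assoc, ← hneg, ← hneg, neg_neg]
  have hper' : ∀ w, Complex.exp (w - 2 * J) = Complex.exp w := fun w => by
    rw [← hper, sub_add_cancel]
  obtain ⟨G, H, hGH⟩ := exists_oddTheta_mul_oddTheta hq hn
  obtain ⟨e, he⟩ : ∃ w : ℂ, w = (1 / 2 - k - sg) * l + J := ⟨_, rfl⟩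
  obtain ⟨m, hm⟩ : ∃ w : ℂ, w = k * l + J / 2 := ⟨_, rfl⟩
  obtain ⟨n, hnn⟩ : ∃ w : ℂ, w = lm * l - J / 2 := ⟨_, rfl⟩
  obtain ⟨p, hp⟩ : ∃ w : ℂ, w = up * l - J / 2 := ⟨_, rfl⟩
  have hm0 : oddTheta q (2 * m) ≠ 0 := oddTheta_ne_zero (t := 2 * k * l) hq0 hq1 (by
    rw [hneg, hm]; congr 1; push_cast; ring)
  have he0 : oddTheta q (2 * m + 2 * e) ≠ 0 :=
    oddTheta_ne_zero (t := (1 - 2 * sg) * l) hq0 hq1 (by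
      rw [hneg, hm, he, ← hper (_ + J)]; congr 1; push_cast; ring)
  have main := four_term (fun y => oddTheta_neg hn y) hGH n p (x * l) (z * l) hm0 he0
  rw [th7_eq (u3 := aP q k lm * qc q x) (y1 := e + x * l + z * l) (y2 := e + x * l - z * l)
      (y3 := m + x * l + n) (y4 := m + x * l - n) (y5 := m + e - x * l - p)
      (y6 := m + e - x * l + p) (y7 := 2 * (z * l)) hq,
    th7_eq (u3 := aP q k up * qc q z) (y1 := e + z * l - x * l) (y2 := e + z * l + x * l)
      (y3 := m + z * l + p) (y4 := m + z * l - p) (y5 := m + e - z * l - n)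
      (y6 := m + e - z * l + n) (y7 := 2 * (x * l)) hq,
    th7_eq (u3 := aP q k lm * qc q (-x)) (y1 := e - x * l - z * l) (y2 := e - x * l + z * l)
      (y3 := m - x * l + n) (y4 := m - x * l - n) (y5 := m + e + x * l - p)
      (y6 := m + e + x * l + p) (y7 := 2 * (z * l)) hq,
    th7_eq (u3 := aP q k up * qc q (-z)) (y1 := e - z * l - x * l) (y2 := e - z * l + x * l)
      (y3 := m - z * l + p) (y4 := m - z * l - p) (y5 := m + e + z * l - n)
      (y6 := m + e + z * l + n) (y7 := 2 * (x * l)) hq]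
  · rw [← mul_assoc (qc q (2 * x)), ← mul_assoc (qc q (2 * z)), qc, qc, hlog, ← Complex.exp_add,
      ← Complex.exp_add]
    have key := congrArg (Complex.exp (2 * m + 2 * e + x * l + z * l) * ·) main
    ring_nf at key ⊢
    linear_combination key
  all_goals
    simp only [aP, bP, cP, dP, qc, hlog, neg_div, neg_mul]
    try simp only [hql, ← Complex.exp_add, ← Complex.exp_sub, hneg, he, hm, hnn, hp]
    first
      | refine congrArg Complex.exp ?_
        push_cast
        ring1
      | rw [← hper']
        refine congrArg Complex.exp ?_
        push_cast
        ring1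

end
end

section
/- Fix real parameters κ,λ, a step size s>0, and 0<q<1. Let f:ℂ→ℂ be any function, let μ∈ℂ, and let x∈ℂ be such that q^{2x} ∉ {1, q^s, q^{−s}} (so all denominators below are nonzero). Then the factorization identity ((L−μ)((L+μ)f))(x) = (D^{(s)}_{κ,λ,κ,λ;q} f)(x) + (q^{2κ} + q^{−2κ} + 2 − μ²)·f(x) holds, where L = L^{(s/2)}_{κ,λ;q} is the half-step operator and D^{(s)}_{κ,λ,κ,λ;q} is the Askey–Wilson second order difference operator with Hecke parameters (κ,λ,κ,λ) and step size s. -/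
noncomputable section

/-- The half-step operator `L = L^{(s/2)}_{κ,λ;q}`. -/
def LOp (q s k lm : ℝ) (f : ℂ → ℂ) (x : ℂ) : ℂ :=
  ((1 - qc q (k + lm + x)) * (1 + qc q (k - lm + x)) / (qc q k * (1 - qc q (2 * x)))) *
      f (x + s / 2) +
    ((1 - qc q (k + lm - x)) * (1 + qc q (k - lm - x)) /
      (qc q k * (1 - qc q (-(2 * x))))) * f (x - s / 2)

/-- The Askey–Wilson second order difference operator `D^{(s)}_{κ,λ,υ,ς;q}`. -/
def DOp (q s k lm up sg : ℝ) (f : ℂ → ℂ) (x : ℂ) : ℂ :=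
  AOp q s k lm up sg x * (f (x + s) - f x) + AOp q s k lm up sg (-x) * (f (x - s) - f x)

theorem qc_add (q : ℝ) (x y : ℂ) : qc q (x + y) = qc q x * qc q y := by
  simp only [qc, add_mul, Complex.exp_add]

theorem qc_neg (q : ℝ) (x : ℂ) : qc q (-x) = (qc q x)⁻¹ := by
  simp only [qc, neg_mul, Complex.exp_neg]

theorem qc_sub (q : ℝ) (x y : ℂ) : qc q (x - y) = qc q x * (qc q y)⁻¹ := by
  rw [sub_eq_add_neg, qc_add, qc_neg]

theorem qc_two_mul (q : ℝ) (x : ℂ) : qc q (2 * x) = qc q x ^ 2 := by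
  rw [two_mul, qc_add, sq]

theorem qc_eq_half_sq (q : ℝ) (x : ℂ) : qc q x = qc q (x / 2) ^ 2 := by
  rw [← qc_two_mul, mul_div_cancel₀ _ (two_ne_zero' ℂ)]

theorem qc_ne_zero (q : ℝ) (x : ℂ) : qc q x ≠ 0 := Complex.exp_ne_zero _

/-- The coefficient of the half-step operator as a rational function of `X = q^x`,
with `K = q^κ` and `M = q^λ`. -/
def halfStepCoeff (K M X : ℂ) : ℂ :=
  (1 - K * M * X) * (1 + K * M⁻¹ * X) / (K * (1 - X ^ 2))

theorem halfStepCoeff_add_inv {K M X : ℂ} (hK : K ≠ 0) (hM : M ≠ 0) (hX : X ≠ 0)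
    (hX2 : X ^ 2 ≠ 1) :
    halfStepCoeff K M X + halfStepCoeff K M X⁻¹ = K + K⁻¹ := by
  have h : 1 - X ^ 2 ≠ 0 := sub_ne_zero.mpr hX2.symm
  have hinv : 1 - X⁻¹ ^ 2 = -(1 - X ^ 2) / X ^ 2 := by
    field_simp
    ring
  rw [halfStepCoeff, halfStepCoeff, hinv]
  field_simp
  ring

theorem LOp_eq_halfStepCoeff (q s k lm : ℝ) (f : ℂ → ℂ) (x : ℂ) :
    LOp q s k lm f x =
      halfStepCoeff (qc q k) (qc q lm) (qc q x) * f (x + s / 2) +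
        halfStepCoeff (qc q k) (qc q lm) (qc q x)⁻¹ * f (x - s / 2) := by
  simp only [LOp, halfStepCoeff, qc_add, qc_sub, qc_neg, qc_two_mul, inv_pow]

theorem AOp_eq_halfStepCoeff_mul (q s k lm : ℝ) (x : ℂ) :
    AOp q s k lm k lm x =
      halfStepCoeff (qc q k) (qc q lm) (qc q x) *
        halfStepCoeff (qc q k) (qc q lm) (qc q (s / 2) * qc q x) := by
  simp only [AOp, aP, bP, cP, dP, halfStepCoeff, qc_add, qc_sub, qc_two_mul, qc_eq_half_sq q s]
  rw [div_mul_div_comm]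
  congr 1 <;> ring

/-- the factorization identity
`((L-μ)((L+μ)f))(x) = (D^{(s)}_{κ,λ,κ,λ;q} f)(x) + (q^{2κ}+q^{-2κ}+2-μ²) f(x)`. -/
theorem stmt11 (q s k lm : ℝ) (hq0 : 0 < q) (hq1 : q < 1) (hs : 0 < s)
    (f : ℂ → ℂ) (μ : ℂ) (x : ℂ)
    (h1 : qc q (2 * x) ≠ 1) (h2 : qc q (2 * x) ≠ qc q s) (h3 : qc q (2 * x) ≠ qc q (-s)) :
    LOp q s k lm (fun y => LOp q s k lm f y + μ * f y) x -
      μ * (LOp q s k lm f x + μ * f x) =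
    DOp q s k lm k lm f x + (qc q (2 * k) + qc q (-(2 * k)) + 2 - μ ^ 2) * f x := by
  have hS := qc_ne_zero q (s / 2)
  have hX := qc_ne_zero q x
  have hK := qc_ne_zero q k
  have hM := qc_ne_zero q lm
  rw [qc_two_mul] at h1 h2 h3
  rw [qc_eq_half_sq q s] at h2
  rw [qc_neg, qc_eq_half_sq q s] at h3
  have hup : (qc q (s / 2) * qc q x) ^ 2 ≠ 1 := fun h =>
    h3 (eq_inv_of_mul_eq_one_right (by rw [← mul_pow, h]))
  have hdown : (qc q (s / 2) * (qc q x)⁻¹) ^ 2 ≠ 1 := fun h =>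
    h2 (by field_simp at h; exact h.symm)
  have e0 := halfStepCoeff_add_inv hK hM hX h1
  have e1 := halfStepCoeff_add_inv hK hM (mul_ne_zero hS hX) hup
  have e2 := halfStepCoeff_add_inv hK hM (mul_ne_zero hS (inv_ne_zero hX)) hdown
  have hKK : qc q (2 * k) + qc q (-(2 * k)) + 2 = (qc q k + (qc q k)⁻¹) ^ 2 := by
    rw [qc_neg, qc_two_mul]
    field_simp
    ring
  have a1 : x + s / 2 + s / 2 = x + (s : ℂ) := by ring
  have a2 : x - s / 2 - s / 2 = x - (s : ℂ) := by ring
  have x1 : qc q (x + s / 2) = qc q (s / 2) * qc q x := by rw [qc_add, mul_comm]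
  have x2 : qc q (x - s / 2) = (qc q (s / 2) * (qc q x)⁻¹)⁻¹ := by
    rw [qc_sub, mul_inv, inv_inv, mul_comm]
  rw [hKK]
  simp only [LOp_eq_halfStepCoeff, DOp, AOp_eq_halfStepCoeff_mul, qc_neg, x1, x2, inv_inv,
    add_sub_cancel_right, sub_add_cancel, a1, a2]
  linear_combination
    (halfStepCoeff (qc q k) (qc q lm) (qc q x) * e1 +
      halfStepCoeff (qc q k) (qc q lm) (qc q x)⁻¹ * e2 +
      (qc q k + (qc q k)⁻¹) * e0) * f x

end
end
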